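/- Under the hypotheses guaranteeing the short exact sequence 0 → H^m(G,B) → H^m(G,B/A) → H^{m+1}(G,A) → 0 (namely B free of finite rank over ℤ_p, A ≤ e·B and A ≤ f·B with e = exp H^m(G,B), f = exp H^{m+1}(G,A)), this short exact sequence splits; hence H^m(G,B/A) ≅ H^m(G,B) ⊕ H^{m+1}(G,A). -/

import Mathlib

namespace GroupCoh

variable (G : Type) [Group G] (M : Type) [AddCommGroup M] [DistribMulAction G M]

/-- Coboundary map on inhomogeneous cochains. -/
def d (m : ℕ) : ((Fin m → G) → M) →+ ((Fin (m + 1) → G) → M) where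
  toFun c := fun g => g 0 • c (fun i => g i.succ) +
    ∑ j : Fin (m + 1), ((-1 : ℤ) ^ ((j : ℕ) + 1)) • c (Fin.contractNth j (· * ·) g)
  map_zero' := by funext g; simp
  map_add' c₁ c₂ := by
    funext g
    simp only [Pi.add_apply, smul_add, Finset.sum_add_distrib]
    abel

/-- Cocycles. -/
def Zc (m : ℕ) : AddSubgroup ((Fin m → G) → M) := (d G M m).ker

/-- Coboundaries. -/
def Bc : (m : ℕ) → AddSubgroup ((Fin m → G) → M)
  | 0 => ⊥
  | (m + 1) => (d G M m).range

/-- Cohomology. -/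
def H (m : ℕ) : Type := Zc G M m ⧸ ((Bc G M m).addSubgroupOf (Zc G M m))

noncomputable instance (m : ℕ) : AddCommGroup (H G M m) :=
  QuotientAddGroup.Quotient.addCommGroup _

/-- Class of a cocycle. -/
def mkH (m : ℕ) (c : (Fin m → G) → M) (hc : c ∈ Zc G M m) : H G M m :=
  QuotientAddGroup.mk ⟨c, hc⟩

end GroupCoh

open GroupCoh

namespace GroupCohAux

theorem finite_of_surj (p : ℕ) [Fact p.Prime] {M N : Type} [AddCommGroup M]
    [Module (PadicInt p) M] [Module.Finite (PadicInt p) M] [AddCommGroup N]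
    (φ : M →+ N) (hφ : Function.Surjective φ) (f : ℕ) (hf : f ≠ 0)
    (hN : ∀ x : N, f • x = 0) : Finite N := by
  classical
  have key : ∀ r : PadicInt p, ∃ (a : ℕ) (y : PadicInt p), r = a + f * y := by
    intro r
    have hf0 : (f : PadicInt p) ≠ 0 := by exact_mod_cast hf
    have h := PadicInt.unitCoeff_spec hf0
    have h2 := PadicInt.appr_spec (f : PadicInt p).valuation r
    rw [Ideal.mem_span_singleton] at h2
    obtain ⟨c, hc⟩ := h2
    refine ⟨r.appr (f : PadicInt p).valuation,
      ((PadicInt.unitCoeff hf0)⁻¹ : (PadicInt p)ˣ) * c, ?_⟩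
    have h3 : (f : PadicInt p) * (((PadicInt.unitCoeff hf0)⁻¹ : (PadicInt p)ˣ) * c)
        = (p : PadicInt p) ^ (f : PadicInt p).valuation * c := by
      have h4 : ∀ t : PadicInt p, (f : PadicInt p) * t =
          ((PadicInt.unitCoeff hf0 : (PadicInt p)ˣ) : PadicInt p) *
            (p : PadicInt p) ^ (f : PadicInt p).valuation * t := fun t => congrArg (· * t) h
      rw [h4]
      calc _ = ((PadicInt.unitCoeff hf0 : (PadicInt p)ˣ) : PadicInt p) *
            ((PadicInt.unitCoeff hf0)⁻¹ : (PadicInt p)ˣ) *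
            ((p : PadicInt p) ^ (f : PadicInt p).valuation * c) := by ring
        _ = _ := by rw [Units.mul_inv, one_mul]
    rw [h3, ← hc]; ring
  obtain ⟨s, hs⟩ := (Module.Finite.fg_top : (⊤ : Submodule (PadicInt p) M).FG)
  have hcl : ∀ z : M, φ z ∈ AddSubgroup.closure (φ '' (s : Set M)) := by
    intro z
    have hz : z ∈ Submodule.span (PadicInt p) (s : Set M) := by rw [hs]; trivial
    induction hz using Submodule.span_induction with
    | mem x hx => exact AddSubgroup.subset_closure ⟨x, hx, rfl⟩
    | zero => rw [map_zero]; exact zero_mem _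
    | add x y _ _ hx hy => rw [map_add]; exact add_mem hx hy
    | smul r x _ hx =>
      obtain ⟨a, y, rfl⟩ := key r
      have : φ (((a : PadicInt p) + f * y) • x) = a • φ x := by
        rw [add_smul, mul_smul, map_add, Nat.cast_smul_eq_nsmul, Nat.cast_smul_eq_nsmul,
          map_nsmul, map_nsmul, hN, add_zero]
      rw [this]; exact nsmul_mem hx a
  have : AddGroup.FG N := by
    refine ⟨⟨s.image φ, ?_⟩⟩
    rw [eq_top_iff]
    intro n _
    obtain ⟨z, rfl⟩ := hφ n
    simpa using hcl z
  refine AddCommGroup.finite_of_fg_isAddTorsion _ ?_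
  intro x
  exact isOfFinAddOrder_iff_nsmul_eq_zero.2 ⟨f, Nat.pos_of_ne_zero hf, hN x⟩

theorem exists_section {K N : Type} [AddCommGroup K] [AddCommGroup N] [Finite N]
    (δ : K →+ N)
    (h : ∀ (n : ℕ) (x : N), n = addOrderOf x → ∃ y, δ y = x ∧ n • y = 0) :
    ∃ sec : N →+ K, δ.comp sec = AddMonoidHom.id _ := by
  classical
  obtain ⟨I, _, n, hn, ⟨E⟩⟩ := AddCommGroup.equiv_directSum_zmod_of_finite' N
  have h1 : ∀ i, ∃ y, δ y = E.symm (DirectSum.of (fun i => ZMod (n i)) i 1) ∧ n i • y = 0 := by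
    intro i
    obtain ⟨y, hy, hy'⟩ := h _ (E.symm (DirectSum.of (fun i => ZMod (n i)) i 1)) rfl
    refine ⟨y, hy, ?_⟩
    have hd : addOrderOf (E.symm (DirectSum.of (fun i => ZMod (n i)) i 1)) ∣ n i := by
      rw [addOrderOf_dvd_iff_nsmul_eq_zero, ← map_nsmul, ← map_nsmul]
      simp
    obtain ⟨k, hk⟩ := hd
    rw [hk, mul_comm, mul_smul, hy', smul_zero]
  choose y hy hy0 using h1
  let t : (DirectSum I fun i => ZMod (n i)) →+ K :=
    DirectSum.toAddMonoid fun i => ZMod.lift (n i) ⟨zmultiplesHom K (y i), by simp [hy0]⟩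
  have ht : δ.comp t = E.symm.toAddMonoidHom := by
    refine DirectSum.addHom_ext fun i z => ?_
    obtain ⟨z, rfl⟩ := ZMod.intCast_surjective z
    simp only [t, AddMonoidHom.comp_apply, DirectSum.toAddMonoid_of, ZMod.lift_coe]
    have : (z : ZMod (n i)) = z • (1 : ZMod (n i)) := by simp
    rw [this, map_zsmul]
    simp [hy]
  refine ⟨t.comp E.toAddMonoidHom, ?_⟩
  ext x
  have := DFunLike.congr_fun ht (E x)
  simpa using this

theorem split_equiv {L K N : Type} [AddCommGroup L] [AddCommGroup K] [AddCommGroup N]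
    (F : L →+ K) (δ : K →+ N) (hF : Function.Injective F) (hex : Function.Exact F δ)
    (sec : N →+ K) (hs : δ.comp sec = AddMonoidHom.id _) : Nonempty (K ≃+ L × N) := by
  have hs' : ∀ x, δ (sec x) = x := fun x => DFunLike.congr_fun hs x
  refine ⟨(AddEquiv.ofBijective (F.coprod sec) ⟨?_, ?_⟩).symm⟩
  · rw [injective_iff_map_eq_zero]
    rintro ⟨b, a⟩ h
    simp only [AddMonoidHom.coprod_apply] at h
    have h2 := congrArg δ h
    rw [map_add, hs', hex.apply_apply_eq_zero, zero_add, map_zero] at h2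
    subst h2
    rw [map_zero, add_zero] at h
    rw [(injective_iff_map_eq_zero F).1 hF b h]; rfl
  · intro k
    obtain ⟨b, hb⟩ := (hex (k - sec (δ k))).1 (by rw [map_sub, hs', sub_self])
    exact ⟨(b, δ k), by simp [hb]⟩

section

variable {G : Type} [Group G] {M N : Type} [AddCommGroup M] [DistribMulAction G M]
  [AddCommGroup N] [DistribMulAction G N]

theorem d_d (m : ℕ) (c : (Fin m → G) → M) : d G M (m + 1) (d G M m c) = 0 := by
  have h := groupCohomology.inhomogeneousCochains.d_comp_d m (Rep.ofDistribMulAction ℤ G M)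
  have h2 := congrArg (fun t => t.hom c) h
  exact h2

theorem d_map (φ : M →+ N) (hφ : ∀ (g : G) (x : M), φ (g • x) = g • φ x) (m : ℕ)
    (c : (Fin m → G) → M) : d G N m (fun x => φ (c x)) = fun x => φ (d G M m c x) := by
  funext x
  simp [d, hφ]

theorem Bc_le (m : ℕ) {c : (Fin m → G) → M} (hc : c ∈ Bc G M m) : d G M m c = 0 := by
  cases m with
  | zero =>
    have : c = 0 := hc
    rw [this, map_zero]
  | succ m =>
    obtain ⟨b, rfl⟩ := hc
    exact d_d m b

theorem mk_eq_zero (m : ℕ) (c : (Fin m → G) → M) (hc : c ∈ Zc G M m) :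
    mkH G M m c hc = 0 ↔ c ∈ Bc G M m := by
  refine (QuotientAddGroup.eq_zero_iff _).trans ?_
  exact AddSubgroup.mem_addSubgroupOf

theorem mk_add (m : ℕ) (c c' : (Fin m → G) → M) (hc : c ∈ Zc G M m) (hc' : c' ∈ Zc G M m) :
    mkH G M m c hc + mkH G M m c' hc' = mkH G M m (c + c') (add_mem hc hc') := rfl

theorem mk_sub (m : ℕ) (c c' : (Fin m → G) → M) (hc : c ∈ Zc G M m) (hc' : c' ∈ Zc G M m) :
    mkH G M m c hc - mkH G M m c' hc' = mkH G M m (c - c') (sub_mem hc hc') := rfl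

theorem mk_nsmul (m n : ℕ) (c : (Fin m → G) → M) (hc : c ∈ Zc G M m) :
    n • mkH G M m c hc = mkH G M m (n • c) (nsmul_mem hc n) := rfl

theorem mk_surj (m : ℕ) (x : H G M m) : ∃ c hc, x = mkH G M m c hc := by
  obtain ⟨⟨c, hc⟩, rfl⟩ := QuotientAddGroup.mk_surjective x
  exact ⟨c, hc, rfl⟩

theorem Bc_map (φ : M →+ N) (hφ : ∀ (g : G) (x : M), φ (g • x) = g • φ x) (m : ℕ)
    {c : (Fin m → G) → M} (hc : c ∈ Bc G M m) : (fun x => φ (c x)) ∈ Bc G N m := by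
  cases m with
  | zero =>
    have : c = 0 := hc
    subst this
    change _ = _
    funext x; simp
  | succ m =>
    obtain ⟨b, rfl⟩ := hc
    exact ⟨fun x => φ (b x), d_map φ hφ m b⟩

theorem Zc_map (φ : M →+ N) (hφ : ∀ (g : G) (x : M), φ (g • x) = g • φ x) (m : ℕ)
    {c : (Fin m → G) → M} (hc : c ∈ Zc G M m) : (fun x => φ (c x)) ∈ Zc G N m := by
  have h : d G M m c = 0 := hc
  change d G N m _ = 0
  rw [d_map φ hφ, h]
  funext x; simp

theorem Bc_lift (φ : M →+ N) (hφ : ∀ (g : G) (x : M), φ (g • x) = g • φ x)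
    (hs : Function.Surjective φ) (m : ℕ)
    {c : (Fin m → G) → N} (hc : c ∈ Bc G N m) :
    ∃ b ∈ Bc G M m, c = fun x => φ (b x) := by
  cases m with
  | zero =>
    have : c = 0 := hc
    subst this
    exact ⟨0, zero_mem _, by funext x; simp⟩
  | succ m =>
    obtain ⟨b, rfl⟩ := hc
    refine ⟨d G M m (fun x => Function.surjInv hs (b x)), ⟨_, rfl⟩, ?_⟩
    rw [← d_map φ hφ]
    congr 1
    funext x
    rw [Function.surjInv_eq hs]

/-- The induced map on cohomology. -/
noncomputable def mapH (φ : M →+ N) (hφ : ∀ (g : G) (x : M), φ (g • x) = g • φ x) (m : ℕ) :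
    H G M m →+ H G N m :=
  QuotientAddGroup.lift _
    (AddMonoidHom.mk' (fun c : Zc G M m => mkH G N m (fun x => φ (c.1 x)) (Zc_map φ hφ m c.2))
      (by
        intro a b
        rw [mk_add]
        congr 1
        funext x
        simp))
    (by
      rintro ⟨c, hc⟩ h
      exact (mk_eq_zero _ _ _).2 (Bc_map φ hφ m h))

theorem mapH_mk (φ : M →+ N) (hφ : ∀ (g : G) (x : M), φ (g • x) = g • φ x) (m : ℕ)
    (c : (Fin m → G) → M) (hc : c ∈ Zc G M m) :
    mapH φ hφ m (mkH G M m c hc) = mkH G N m (fun x => φ (c x)) (Zc_map φ hφ m hc) := rfl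

end

section

variable {G : Type} [Group G] {A B Q : Type} [AddCommGroup A] [DistribMulAction G A]
  [AddCommGroup B] [DistribMulAction G B] [AddCommGroup Q] [DistribMulAction G Q]

/-- The connecting relation. -/
def Rel (ι : A →+ B) (π : B →+ Q) (m : ℕ) (y : H G Q m) (x : H G A (m + 1)) : Prop :=
  ∃ (c : (Fin m → G) → B) (a : (Fin (m + 1) → G) → A)
    (ha : a ∈ Zc G A (m + 1)) (hq : (fun x => π (c x)) ∈ Zc G Q m),
    (∀ x, ι (a x) = d G B m c x) ∧ y = mkH G Q m (fun x => π (c x)) hq ∧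
      x = mkH G A (m + 1) a ha

theorem exists_factor {n : ℕ} (ι : A →+ B) (hι : ∀ (g : G) (a : A), ι (g • a) = g • ι a)
    (htf : ∀ (n : ℕ) (b : B), n ≠ 0 → n • b = 0 → b = 0)
    (h : ∀ a : A, ∃ b : B, ι a = n • b) :
    ∃ φ : A →+ B, (∀ (g : G) (a : A), φ (g • a) = g • φ a) ∧ ∀ a, ι a = n • φ a := by
  by_cases hn : n = 0
  · subst hn
    refine ⟨0, by simp, fun a => ?_⟩
    obtain ⟨b, hb⟩ := h a
    rw [hb]; simp
  choose φ hφ using h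
  have inj : ∀ b b' : B, n • b = n • b' → b = b' := fun b b' hb =>
    sub_eq_zero.1 (htf n _ hn (by rw [smul_sub, hb, sub_self]))
  refine ⟨AddMonoidHom.mk' φ ?_, ?_, hφ⟩
  · intro a b
    apply inj
    rw [smul_add, ← hφ, ← hφ, ← hφ, map_add]
  · intro g a
    apply inj
    change n • φ (g • a) = n • (g • φ a)
    rw [← hφ, hι, hφ, smul_comm]

variable (ι : A →+ B) (π : B →+ Q) (m : ℕ)

theorem cocycle_of
    (hι : ∀ (g : G) (a : A), ι (g • a) = g • ι a)
    (hinj : Function.Injective ι)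
    {c : (Fin m → G) → B} {a : (Fin (m + 1) → G) → A}
    (h : ∀ x, ι (a x) = d G B m c x) : a ∈ Zc G A (m + 1) := by
  change d G A (m + 1) a = 0
  funext x
  apply hinj
  have h1 := congrFun (d_map ι hι (m + 1) a) x
  rw [← h1, show (fun x => ι (a x)) = d G B m c from funext h, d_d]
  simp

theorem rel_exists
    (hι : ∀ (g : G) (a : A), ι (g • a) = g • ι a)
    (hπ : ∀ (g : G) (b : B), π (g • b) = g • π b)
    (hinj : Function.Injective ι)
    (hsurj : Function.Surjective π)
    (hexact : Function.Exact ι π)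
    (y : H G Q m) : ∃ x, Rel ι π m y x := by
  obtain ⟨q, hq, rfl⟩ := mk_surj m y
  obtain ⟨c, rfl⟩ : ∃ c : (Fin m → G) → B, q = fun x => π (c x) :=
    ⟨fun x => Function.surjInv hsurj (q x), by funext x; rw [Function.surjInv_eq hsurj]⟩
  have hq' : d G Q m (fun x => π (c x)) = 0 := hq
  rw [d_map π hπ] at hq'
  have : ∀ x, ∃ a, ι a = d G B m c x := fun x => (hexact _).1 (congrFun hq' x)
  choose a ha using this
  exact ⟨_, c, a, cocycle_of ι m hι hinj ha, hq, ha, rfl, rfl⟩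

theorem rel_zero
    (hι : ∀ (g : G) (a : A), ι (g • a) = g • ι a)
    (hπ : ∀ (g : G) (b : B), π (g • b) = g • π b)
    (hinj : Function.Injective ι)
    (hsurj : Function.Surjective π)
    (hexact : Function.Exact ι π)
    {x : H G A (m + 1)} (h : Rel ι π m (0 : H G Q m) x) : x = 0 := by
  obtain ⟨c, a, ha, hq, hac, h0, rfl⟩ := h
  rw [mk_eq_zero]
  obtain ⟨b, hb, hbc⟩ := Bc_lift π hπ hsurj m ((mk_eq_zero _ _ _).1 h0.symm)
  have : ∀ x, ∃ a, ι a = c x - b x := fun x => (hexact _).1 (by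
    rw [map_sub, congrFun hbc x, sub_self])
  choose a' ha' using this
  refine ⟨a', ?_⟩
  funext x
  apply hinj
  rw [← congrFun (d_map ι hι m a') x, show (fun x => ι (a' x)) = c - b from funext ha',
    map_sub, Bc_le m hb, sub_zero, hac]

theorem rel_add {y y' : H G Q m} {x x' : H G A (m + 1)} (h : Rel ι π m y x)
    (h' : Rel ι π m y' x') : Rel ι π m (y + y') (x + x') := by
  obtain ⟨c, a, ha, hq, hac, rfl, rfl⟩ := h
  obtain ⟨c', a', ha', hq', hac', rfl, rfl⟩ := h'
  have e : (fun x => π ((c + c') x)) = (fun x => π (c x)) + fun x => π (c' x) := by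
    funext x; simp
  refine ⟨c + c', a + a', add_mem ha ha', by rw [e]; exact add_mem hq hq', ?_, ?_, rfl⟩
  · intro x
    simp [hac, hac']
  · rw [mk_add]; congr 1; exact e.symm

theorem rel_neg {y : H G Q m} {x : H G A (m + 1)} (h : Rel ι π m y x) :
    Rel ι π m (-y) (-x) := by
  obtain ⟨c, a, ha, hq, hac, rfl, rfl⟩ := h
  have e : (fun x => π ((-c) x)) = -(fun x => π (c x)) := by
    funext x; simp
  refine ⟨-c, -a, neg_mem ha, by rw [e]; exact neg_mem hq, ?_, ?_, rfl⟩
  · intro x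
    simp [hac]
  · change mkH G Q m _ (neg_mem hq) = _
    congr 1; exact e.symm

theorem exists_delta
    (hι : ∀ (g : G) (a : A), ι (g • a) = g • ι a)
    (hπ : ∀ (g : G) (b : B), π (g • b) = g • π b)
    (hinj : Function.Injective ι)
    (hsurj : Function.Surjective π)
    (hexact : Function.Exact ι π)
    : ∃ δ : H G Q m →+ H G A (m + 1), ∀ (y : H G Q m) (x : H G A (m + 1)), Rel ι π m y x ↔ δ y = x := by
  have huniq : ∀ (y : H G Q m) (x x' : H G A (m + 1)), Rel ι π m y x → Rel ι π m y x' → x = x' := by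
    intro y x x' h h'
    have := rel_add ι π m h (rel_neg ι π m h')
    rw [add_neg_cancel] at this
    have := rel_zero ι π m hι hπ hinj hsurj hexact this
    rwa [add_neg_eq_zero] at this
  choose D hD using rel_exists (G := G) ι π m hι hπ hinj hsurj hexact
  refine ⟨AddMonoidHom.mk' D fun y y' => huniq _ _ _ (hD _) (rel_add ι π m (hD _) (hD _)), ?_⟩
  intro y x
  exact ⟨fun h => huniq _ _ _ (hD y) h, fun h => h ▸ hD y⟩

theorem map_injective
    (hι : ∀ (g : G) (a : A), ι (g • a) = g • ι a)
    (hπ : ∀ (g : G) (b : B), π (g • b) = g • π b)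
    (hinj : Function.Injective ι)
    (hsurj : Function.Surjective π)
    (hexact : Function.Exact ι π)
    (e : ℕ) (he : ∀ x : H G B m, e • x = 0)
    (htf : ∀ (n : ℕ) (b : B), n ≠ 0 → n • b = 0 → b = 0)
    (h : ∀ a : A, ∃ b : B, ι a = e • b) : Function.Injective (mapH π hπ m) := by
  obtain ⟨φ, hφ, hφe⟩ := exists_factor (G := G) ι hι htf h
  rw [injective_iff_map_eq_zero]
  intro x hx
  obtain ⟨c, hc, rfl⟩ := mk_surj m x
  rw [mapH_mk, mk_eq_zero] at hx
  obtain ⟨b, hb, hbc⟩ := Bc_lift π hπ hsurj m hx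
  have : ∀ x, ∃ a, ι a = c x - b x := fun x => (hexact _).1 (by
    rw [map_sub, congrFun hbc x, sub_self])
  choose a ha using this
  have hcb : c - b ∈ Zc G B m := sub_mem hc (Bc_le m hb)
  have haZ : a ∈ Zc G A m := by
    change d G A m a = 0
    funext x
    apply hinj
    rw [← congrFun (d_map ι hι m a) x, show (fun x => ι (a x)) = c - b from funext ha,
      show d G B m (c - b) = 0 from hcb]
    simp
  have h1 := he (mkH G B m (fun x => φ (a x)) (Zc_map φ hφ m haZ))
  rw [mk_nsmul, mk_eq_zero] at h1
  have h2 : e • (fun x => φ (a x)) = c - b := by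
    funext x
    rw [Pi.smul_apply, ← hφe, ha]; rfl
  rw [h2] at h1
  rw [mk_eq_zero]
  simpa using add_mem h1 hb

theorem lift_order
    (hι : ∀ (g : G) (a : A), ι (g • a) = g • ι a)
    (hexact : Function.Exact ι π)
    (f : ℕ) (htf : ∀ (n : ℕ) (b : B), n ≠ 0 → n • b = 0 → b = 0)
    (h : ∀ a : A, ∃ b : B, ι a = f • b) (hπ : ∀ (g : G) (b : B), π (g • b) = g • π b)
    (n : ℕ) (hn : n ∣ f) (x : H G A (m + 1)) (hx : n • x = 0) :
    ∃ y : H G Q m, Rel ι π m y x ∧ n • y = 0 := by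
  obtain ⟨φ, hφ, hφf⟩ := exists_factor (G := G) ι hι htf h
  obtain ⟨k, rfl⟩ := hn
  obtain ⟨a, ha, rfl⟩ := mk_surj _ x
  rw [mk_nsmul, mk_eq_zero] at hx
  obtain ⟨a', ha'⟩ := hx
  let c : (Fin m → G) → B := k • fun x => φ (a' x)
  have hc : ∀ x, ι (a x) = d G B m c x := by
    intro x
    simp only [c]
    rw [map_nsmul, d_map φ hφ, ha', Pi.smul_apply, hφf]
    simp only [Pi.smul_apply, map_nsmul]
    rw [smul_smul, mul_comm]
  have hq : (fun x => π (c x)) ∈ Zc G Q m := by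
    change d G Q m _ = 0
    rw [d_map π hπ]
    funext x
    rw [← hc, hexact.apply_apply_eq_zero]; rfl
  refine ⟨_, ⟨c, a, ha, hq, hc, rfl, rfl⟩, ?_⟩
  rw [mk_nsmul, mk_eq_zero]
  convert zero_mem (Bc G Q m)
  funext x
  simp only [c, Pi.smul_apply, Pi.zero_apply]
  rw [← map_nsmul, smul_smul, ← hφf, hexact.apply_apply_eq_zero]

theorem exact_delta
    (hπ : ∀ (g : G) (b : B), π (g • b) = g • π b)
    (hexact : Function.Exact ι π)
    (hι : ∀ (g : G) (a : A), ι (g • a) = g • ι a)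
    (δ : H G Q m →+ H G A (m + 1)) (hδ : ∀ (y : H G Q m) (x : H G A (m + 1)), Rel ι π m y x ↔ δ y = x) :
    Function.Exact (mapH π hπ m) δ := by
  intro y
  constructor
  · intro h
    obtain ⟨c, a, ha, hq, hac, rfl, h0⟩ := (hδ _ _).2 h
    obtain ⟨a', rfl⟩ := (mk_eq_zero _ _ _).1 h0.symm
    have hz : (c - fun x => ι (a' x)) ∈ Zc G B m := by
      change d G B m _ = 0
      rw [map_sub, d_map ι hι]
      funext x
      simp [hac]
    refine ⟨mkH G B m _ hz, ?_⟩
    rw [mapH_mk]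
    congr 1
    funext x
    simp [hexact.apply_apply_eq_zero]
  · rintro ⟨x, rfl⟩
    obtain ⟨c, hc, rfl⟩ := mk_surj _ x
    refine (hδ _ _).1 ⟨c, 0, zero_mem _, Zc_map π hπ m hc, ?_, rfl, rfl⟩
    intro x
    rw [show d G B m c = 0 from hc]
    simp

theorem finite_H (p : ℕ) [Fact p.Prime] [Finite G] [Module (PadicInt p) A]
    [SMulCommClass G (PadicInt p) A] [IsNoetherian (PadicInt p) A] (f : ℕ) (hf : f ≠ 0)
    (hN : ∀ x : H G A m, f • x = 0) : Finite (H G A m) := by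
  let Z : Submodule (PadicInt p) ((Fin m → G) → A) :=
    { Zc G A m with
      smul_mem' := by
        intro r c hc
        have hc' : d G A m c = 0 := hc
        change d G A m (fun x => DistribSMul.toAddMonoidHom A r (c x)) = 0
        rw [d_map (DistribSMul.toAddMonoidHom A r) (fun g x => (smul_comm g r x).symm), hc']
        funext x; simp }
  let φ : Z →+ H G A m := AddMonoidHom.mk' (fun z => mkH G A m z.1 z.2) (fun _ _ => rfl)
  refine finite_of_surj p φ ?_ f hf hN
  intro x
  obtain ⟨c, hc, rfl⟩ := mk_surj _ x
  exact ⟨⟨c, hc⟩, rfl⟩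

end

end GroupCohAux

open GroupCohAux

/-- Under the hypotheses guaranteeing the short exact sequence
`0 → H^m(G,B) → H^m(G,B/A) → H^{m+1}(G,A) → 0` (namely `B` free of finite rank over `ℤ_p`,
`A ≤ e·B` and `A ≤ f·B` with `e = exp H^m(G,B)`, `f = exp H^{m+1}(G,A)`), this short exact
sequence splits; hence `H^m(G,B/A) ≅ H^m(G,B) ⊕ H^{m+1}(G,A)`. -/
theorem split_short_exact_sequence_of_submodule_of_smul (p : ℕ) [Fact p.Prime]
    (G : Type) [Group G] [Fintype G] (m : ℕ)
    (A : Type) [AddCommGroup A] [Module (PadicInt p) A] [DistribMulAction G A]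
    [SMulCommClass G (PadicInt p) A]
    (B : Type) [AddCommGroup B] [Module (PadicInt p) B] [DistribMulAction G B]
    [SMulCommClass G (PadicInt p) B]
    [Module.Free (PadicInt p) B] [Module.Finite (PadicInt p) B]
    (Q : Type) [AddCommGroup Q] [Module (PadicInt p) Q] [DistribMulAction G Q]
    [SMulCommClass G (PadicInt p) Q]
    (ι : A →ₗ[PadicInt p] B) (π : B →ₗ[PadicInt p] Q)
    (hι : ∀ (g : G) (a : A), ι (g • a) = g • ι a)
    (hπ : ∀ (g : G) (b : B), π (g • b) = g • π b)
    (hinj : Function.Injective ι) (hsurj : Function.Surjective π)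
    (hexact : Function.Exact ι π)
    (f : ℕ) (hf : f = AddMonoid.exponent (H G A (m + 1)))
    (hAfB : ∀ a : A, ∃ b : B, ι a = f • b)
    (e : ℕ) (he : e = AddMonoid.exponent (H G B m))
    (hAeB : ∀ a : A, ∃ b : B, ι a = e • b) :
    (∃ (F : H G B m →+ H G Q m) (δ : H G Q m →+ H G A (m + 1)),
      (∀ (c : (Fin m → G) → B) (hc : c ∈ Zc G B m) (hc' : (fun x => π (c x)) ∈ Zc G Q m),
          F (mkH G B m c hc) = mkH G Q m (fun x => π (c x)) hc') ∧
      (∀ (c : (Fin m → G) → B) (a : (Fin (m + 1) → G) → A)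
          (ha : a ∈ Zc G A (m + 1)) (hq : (fun x => π (c x)) ∈ Zc G Q m),
          (∀ x, ι (a x) = d G B m c x) →
          δ (mkH G Q m (fun x => π (c x)) hq) = mkH G A (m + 1) a ha) ∧
      Function.Injective F ∧ Function.Exact F δ ∧ Function.Surjective δ ∧
      (∃ sec : H G A (m + 1) →+ H G Q m, δ.comp sec = AddMonoidHom.id _) ∧
      Nonempty (H G Q m ≃+ H G B m × H G A (m + 1))) := by
  have htf : ∀ (n : ℕ) (b : B), n ≠ 0 → n • b = 0 → b = 0 := by
    intro n b hn hb
    rw [← Nat.cast_smul_eq_nsmul (PadicInt p)] at hb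
    exact (smul_eq_zero.1 hb).resolve_left (by exact_mod_cast hn)
  have heB : ∀ x : H G B m, e • x = 0 := fun x => by
    rw [he]; exact AddMonoid.exponent_nsmul_eq_zero x
  have hfA : ∀ x : H G A (m + 1), f • x = 0 := fun x => by
    rw [hf]; exact AddMonoid.exponent_nsmul_eq_zero x
  have hf0 : f ≠ 0 := by
    intro h0
    have hA : ∀ a : A, a = 0 := by
      intro a
      obtain ⟨b, hb⟩ := hAfB a
      apply hinj
      rw [hb, h0, zero_smul, map_zero]
    have hH : ∀ x : H G A (m + 1), x = 0 := by
      intro x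
      obtain ⟨c, hc, rfl⟩ := mk_surj _ x
      rw [mk_eq_zero]
      convert zero_mem (Bc G A (m + 1))
      funext x
      exact hA _
    have : Subsingleton (H G A (m + 1)) := ⟨fun x y => by rw [hH x, hH y]⟩
    have h1 := AddMonoid.exp_eq_one_of_subsingleton (G := H G A (m + 1))
    omega
  have hNoeth : IsNoetherian (PadicInt p) A := isNoetherian_of_injective ι hinj
  have hfin : Finite (H G A (m + 1)) := finite_H (m + 1) p f hf0 hfA
  obtain ⟨δ, hδ⟩ := exists_delta (G := G) ι.toAddMonoidHom π.toAddMonoidHom m hι hπ hinj hsurj hexact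
  have hFinj := map_injective (G := G) ι.toAddMonoidHom π.toAddMonoidHom m hι hπ hinj hsurj hexact
    e heB htf hAeB
  have hEx := exact_delta (G := G) ι.toAddMonoidHom π.toAddMonoidHom m hπ hexact hι δ hδ
  obtain ⟨sec, hsec⟩ := exists_section δ (by
    rintro n x rfl
    obtain ⟨y, hy, hy0⟩ := lift_order (G := G) ι.toAddMonoidHom π.toAddMonoidHom m hι hexact f htf
      hAfB hπ (addOrderOf x) (addOrderOf_dvd_of_nsmul_eq_zero (hfA x)) x (addOrderOf_nsmul_eq_zero x)
    exact ⟨y, (hδ _ _).1 hy, hy0⟩)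
  refine ⟨mapH π.toAddMonoidHom hπ m, δ, ?_, ?_, hFinj, hEx, ?_, ⟨sec, hsec⟩,
    split_equiv _ δ hFinj hEx sec hsec⟩
  · intro c hc hc'
    rfl
  · intro c a ha hq h
    exact (hδ _ _).1 ⟨c, a, ha, hq, h, rfl, rfl⟩
  · intro x
    exact ⟨sec x, DFunLike.congr_fun hsec x⟩
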